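/- arXiv:2311.08665 — 7 statements merged into one kernel-verified Lean document; each statement's English description precedes it below -/
import Mathlib

section
/- Let λ ∈ ℝ, t₁ ∈ ℕ, let Y₀ = (U₀; V₀) be a prepared matrix solution of system (1.1) with U₀(t) invertible for all t ≥ t₁, and set S₀(t₁) := 0, S₀(t) := Σ_{s=t₁}^{t−1} U₀^{−1}(s+1)Ã(s)B(s)(U₀^{−1})*(s) for t > t₁. (i) If Y = (U; V) is any matrix solution of (1.1) with the same λ, then Q := U₀*(t)V(t) − V₀*(t)U(t) is independent of t, and with P := U₀^{−1}(t₁)U(t₁) one has U(t) = U₀(t)(P + S₀(t)Q) and V(t) = V₀(t)(P + S₀(t)Q) + (U₀^{−1})*(t)Q for all t ≥ t₁. (ii) Conversely, for any constant n×n complex matrices P and Q, the pair (U; V) defined by these formulas for t ≥ t₁ satisfies the equations of (1.1) for all t ≥ t₁. (iii) Such a Y satisfies Y*(t)JY(t) = 0 for all t ≥ t₁ if and only if P*Q is Hermitian. -/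
open Matrix
open scoped ComplexOrder

noncomputable section

/-- The canonical symplectic matrix `J = [[0, -I], [I, 0]]`. -/
def Jmat (n : ℕ) : Matrix (Fin n ⊕ Fin n) (Fin n ⊕ Fin n) ℂ :=
  Matrix.fromBlocks 0 (-1) 1 0

/-- The `2n × n` matrix `Y(t) = (U(t); V(t))`. -/
def Ymat {n : ℕ} (U V : ℕ → Matrix (Fin n) (Fin n) ℂ) (t : ℕ) :
    Matrix (Fin n ⊕ Fin n) (Fin n) ℂ :=
  Matrix.of (Sum.elim (fun i j => U t i j) (fun i j => V t i j))

/-- `Y = (U; V)` is a matrix solution of the discrete linear Hamiltonian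
system (1.1). -/
def IsMatSol {n : ℕ} (A B C W : ℕ → Matrix (Fin n) (Fin n) ℂ) (lam : ℂ)
    (U V : ℕ → Matrix (Fin n) (Fin n) ℂ) : Prop :=
  ∀ t : ℕ,
    U (t + 1) - U t = A t * U (t + 1) + B t * V t ∧
    V (t + 1) - V t = (C t - lam • W t) * U (t + 1) - (A t)ᴴ * V t

/-- A matrix solution is prepared (conjoined) if `Y*(t) J Y(t) = 0` for all `t`. -/
def IsPrepared {n : ℕ} (U V : ℕ → Matrix (Fin n) (Fin n) ℂ) : Prop :=
  ∀ t : ℕ, (Ymat U V t)ᴴ * Jmat n * Ymat U V t = 0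

/-- `S₀(t) = Σ_{s=t₁}^{t−1} U₀⁻¹(s+1)Ã(s)B(s)(U₀⁻¹)*(s)`, `S₀(t₁) = 0`. -/
noncomputable def S0 {n : ℕ} (A B : ℕ → Matrix (Fin n) (Fin n) ℂ)
    (U₀ : ℕ → Matrix (Fin n) (Fin n) ℂ) (t₁ t : ℕ) : Matrix (Fin n) (Fin n) ℂ :=
  ∑ s ∈ Finset.Ico t₁ t, (U₀ (s + 1))⁻¹ * (1 - A s)⁻¹ * B s * ((U₀ s)⁻¹)ᴴ

/-- `U(t) = U₀(t)(P + S₀(t)Q)`. -/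
noncomputable def Uf {n : ℕ} (A B : ℕ → Matrix (Fin n) (Fin n) ℂ)
    (U₀ : ℕ → Matrix (Fin n) (Fin n) ℂ) (t₁ : ℕ)
    (P Q : Matrix (Fin n) (Fin n) ℂ) (t : ℕ) : Matrix (Fin n) (Fin n) ℂ :=
  U₀ t * (P + S0 A B U₀ t₁ t * Q)

/-- `V(t) = V₀(t)(P + S₀(t)Q) + (U₀⁻¹)*(t)Q`. -/
noncomputable def Vf {n : ℕ} (A B : ℕ → Matrix (Fin n) (Fin n) ℂ)
    (U₀ V₀ : ℕ → Matrix (Fin n) (Fin n) ℂ) (t₁ : ℕ)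
    (P Q : Matrix (Fin n) (Fin n) ℂ) (t : ℕ) : Matrix (Fin n) (Fin n) ℂ :=
  V₀ t * (P + S0 A B U₀ t₁ t * Q) + ((U₀ t)⁻¹)ᴴ * Q

section Aux

variable {n : ℕ} {A B H U U' V V' U₁ U₁' V₁ V₁' : Matrix (Fin n) (Fin n) ℂ}

lemma Ymat_form (U V : ℕ → Matrix (Fin n) (Fin n) ℂ) (t : ℕ) :
    (Ymat U V t)ᴴ * Jmat n * Ymat U V t = (V t)ᴴ * U t - (U t)ᴴ * V t := by
  have h : Ymat U V t = Matrix.fromRows (U t) (V t) := rfl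
  rw [h, Jmat, Matrix.conjTranspose_fromRows_eq_fromCols_conjTranspose,
    ← Matrix.fromCols_fromRows_eq_fromBlocks, Matrix.mul_fromCols,
    Matrix.fromCols_mul_fromRows, Matrix.fromCols_mul_fromRows, Matrix.fromCols_mul_fromRows]
  simp [sub_eq_add_neg]

/-- Solved form of one step of the Hamiltonian system. -/
lemma hamiltonian_step_iff :
    (U' - U = A * U' + B * V ∧ V' - V = H * U' - Aᴴ * V) ↔
      (1 - A) * U' = U + B * V ∧ V' = H * U' + (1 - A)ᴴ * V := by
  rw [conjTranspose_sub, conjTranspose_one]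
  refine and_congr ?_ ?_ <;> constructor <;> intro h
  · rw [sub_eq_iff_eq_add] at h
    nth_rewrite 1 [sub_mul, one_mul, h]
    abel
  · rw [sub_mul, one_mul, sub_eq_iff_eq_add] at h
    nth_rewrite 1 [h]
    abel
  · rw [sub_eq_iff_eq_add] at h
    rw [h]
    noncomm_ring
  · rw [h]
    noncomm_ring

/-- The Wronskian of two solutions is preserved by one step of the system. -/
lemma wronskian_step (hB : B.IsHermitian) (hH : H.IsHermitian)
    (h1 : (1 - A) * U' = U + B * V) (h2 : V' = H * U' + (1 - A)ᴴ * V)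
    (h3 : (1 - A) * U₁' = U₁ + B * V₁) (h4 : V₁' = H * U₁' + (1 - A)ᴴ * V₁) :
    Uᴴ * V₁ - Vᴴ * U₁ = U'ᴴ * V₁' - V'ᴴ * U₁' := by
  have e1 : U'ᴴ * (1 - A)ᴴ = Uᴴ + Vᴴ * B := by
    rw [← conjTranspose_mul, h1, conjTranspose_add, conjTranspose_mul, hB.eq]
  have e2 : V'ᴴ = U'ᴴ * H + Vᴴ * (1 - A) := by
    rw [h2, conjTranspose_add, conjTranspose_mul, conjTranspose_mul, hH.eq,
      conjTranspose_conjTranspose]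
  calc Uᴴ * V₁ - Vᴴ * U₁ = (Uᴴ + Vᴴ * B) * V₁ - Vᴴ * (U₁ + B * V₁) := by noncomm_ring
    _ = U'ᴴ * (1 - A)ᴴ * V₁ - Vᴴ * ((1 - A) * U₁') := by rw [e1, h3]
    _ = U'ᴴ * (H * U₁' + (1 - A)ᴴ * V₁) - (U'ᴴ * H + Vᴴ * (1 - A)) * U₁' := by
      noncomm_ring
    _ = U'ᴴ * V₁' - V'ᴴ * U₁' := by rw [h4, e2]

/-- One step of the reduction of order formula built on a prepared solution. -/
lemma reduction_of_order_step (K Q : Matrix (Fin n) (Fin n) ℂ)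
    (hA : IsUnit (1 - A)) (hB : B.IsHermitian) (hU : IsUnit U) (hU' : IsUnit U')
    (hUV : Uᴴ * V = Vᴴ * U)
    (h1 : (1 - A) * U' = U + B * V) (h2 : V' = H * U' + (1 - A)ᴴ * V) :
    (1 - A) * (U' * (K + U'⁻¹ * (1 - A)⁻¹ * B * (U⁻¹)ᴴ * Q)) =
        U * K + B * (V * K + (U⁻¹)ᴴ * Q) ∧
      V' * (K + U'⁻¹ * (1 - A)⁻¹ * B * (U⁻¹)ᴴ * Q) + (U'⁻¹)ᴴ * Q =
        H * (U' * (K + U'⁻¹ * (1 - A)⁻¹ * B * (U⁻¹)ᴴ * Q)) +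
          (1 - A)ᴴ * (V * K + (U⁻¹)ᴴ * Q) := by
  set D := 1 - A
  rw [Matrix.isUnit_iff_isUnit_det] at hA hU hU'
  have hX : D * U' * (U'⁻¹ * D⁻¹) = 1 := by
    rw [mul_assoc, Matrix.mul_nonsing_inv_cancel_left _ _ hU', Matrix.mul_nonsing_inv _ hA]
  have hUinv : Uᴴ * (U⁻¹)ᴴ = 1 := by
    rw [← conjTranspose_mul, Matrix.nonsing_inv_mul _ hU, conjTranspose_one]
  have hUinv' : (U'⁻¹)ᴴ * U'ᴴ = 1 := by
    rw [← conjTranspose_mul, Matrix.mul_nonsing_inv _ hU', conjTranspose_one]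
  have hXH : U'ᴴ * Dᴴ = Uᴴ + Vᴴ * B := by
    rw [← conjTranspose_mul, h1, conjTranspose_add, conjTranspose_mul, hB.eq]
  have hcomm : U'ᴴ * Dᴴ * V = Vᴴ * (D * U') := by
    rw [hXH, h1, add_mul, mul_add, hUV, mul_assoc]
  have key : Dᴴ * V * (U'⁻¹ * D⁻¹) * B * (U⁻¹)ᴴ + (U'⁻¹)ᴴ = Dᴴ * (U⁻¹)ᴴ := by
    calc _ = (U'⁻¹)ᴴ * U'ᴴ * (Dᴴ * V * (U'⁻¹ * D⁻¹) * B * (U⁻¹)ᴴ) + (U'⁻¹)ᴴ := by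
          rw [hUinv', one_mul]
      _ = (U'⁻¹)ᴴ * ((U'ᴴ * Dᴴ * V) * (U'⁻¹ * D⁻¹) * B * (U⁻¹)ᴴ + 1) := by
          simp only [mul_assoc, mul_add, mul_one]
      _ = (U'⁻¹)ᴴ * (Vᴴ * (D * U' * (U'⁻¹ * D⁻¹)) * B * (U⁻¹)ᴴ + 1) := by
          rw [hcomm]; simp only [mul_assoc]
      _ = (U'⁻¹)ᴴ * ((Uᴴ + Vᴴ * B) * (U⁻¹)ᴴ) := by
          rw [hX, mul_one, add_mul, hUinv, add_comm]
      _ = (U'⁻¹)ᴴ * U'ᴴ * (Dᴴ * (U⁻¹)ᴴ) := by rw [← hXH]; simp only [mul_assoc]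
      _ = Dᴴ * (U⁻¹)ᴴ := by rw [hUinv', one_mul]
  constructor
  · calc _ = D * U' * K + D * U' * (U'⁻¹ * D⁻¹) * B * (U⁻¹)ᴴ * Q := by
          simp only [mul_assoc, mul_add]
      _ = _ := by
          rw [hX, h1]
          simp only [mul_assoc, mul_add, add_mul, one_mul, add_assoc]
  · rw [h2]
    calc _ = H * (U' * (K + U'⁻¹ * D⁻¹ * B * (U⁻¹)ᴴ * Q)) + Dᴴ * V * K +
            (Dᴴ * V * (U'⁻¹ * D⁻¹) * B * (U⁻¹)ᴴ + (U'⁻¹)ᴴ) * Q := by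
          simp only [mul_assoc, mul_add, add_mul]
          abel
      _ = _ := by
          rw [key]
          simp only [mul_assoc, mul_add, add_assoc]

end Aux

/-- representation of all matrix solutions in terms of a prepared
matrix solution `Y₀ = (U₀; V₀)` with `U₀(t)` invertible for `t ≥ t₁`:
(i) every matrix solution `Y = (U; V)` has `Q(t) := U₀*(t)V(t) − V₀*(t)U(t)`
constant, and is given by `U = Uf`, `V = Vf` with `P = U₀⁻¹(t₁)U(t₁)` and this
`Q` for `t ≥ t₁`; (ii) conversely, for any constant matrices `P, Q` the pair
`(Uf; Vf)` satisfies the equations of (1.1) for `t ≥ t₁`; (iii) this pair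
satisfies `Y*(t)JY(t) = 0` for all `t ≥ t₁` iff `P*Q` is Hermitian. -/
theorem solution_representation (n : ℕ) (hn : 0 < n)
    (A B C W : ℕ → Matrix (Fin n) (Fin n) ℂ)
    (hA : ∀ t, IsUnit (1 - A t))
    (hB : ∀ t, (B t).PosSemidef)
    (hC : ∀ t, (C t).IsHermitian)
    (hW : ∀ t, (W t).PosSemidef)
    (lam : ℝ) (t₁ : ℕ)
    (U₀ V₀ : ℕ → Matrix (Fin n) (Fin n) ℂ)
    (hY₀ : IsMatSol A B C W (lam : ℂ) U₀ V₀)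
    (hprep : IsPrepared U₀ V₀)
    (hU₀ : ∀ t, t₁ ≤ t → IsUnit (U₀ t)) :
    (∀ U V : ℕ → Matrix (Fin n) (Fin n) ℂ, IsMatSol A B C W (lam : ℂ) U V →
      (∀ s t : ℕ,
        (U₀ s)ᴴ * V s - (V₀ s)ᴴ * U s = (U₀ t)ᴴ * V t - (V₀ t)ᴴ * U t) ∧
      (∀ t, t₁ ≤ t →
        U t = Uf A B U₀ t₁ ((U₀ t₁)⁻¹ * U t₁)
          ((U₀ t₁)ᴴ * V t₁ - (V₀ t₁)ᴴ * U t₁) t ∧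
        V t = Vf A B U₀ V₀ t₁ ((U₀ t₁)⁻¹ * U t₁)
          ((U₀ t₁)ᴴ * V t₁ - (V₀ t₁)ᴴ * U t₁) t)) ∧
    (∀ P Q : Matrix (Fin n) (Fin n) ℂ, ∀ t, t₁ ≤ t →
      (Uf A B U₀ t₁ P Q (t + 1) - Uf A B U₀ t₁ P Q t
        = A t * Uf A B U₀ t₁ P Q (t + 1) + B t * Vf A B U₀ V₀ t₁ P Q t) ∧
      (Vf A B U₀ V₀ t₁ P Q (t + 1) - Vf A B U₀ V₀ t₁ P Q t
        = (C t - (lam : ℂ) • W t) * Uf A B U₀ t₁ P Q (t + 1)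
          - (A t)ᴴ * Vf A B U₀ V₀ t₁ P Q t)) ∧
    (∀ P Q : Matrix (Fin n) (Fin n) ℂ,
      (∀ t, t₁ ≤ t →
        (Ymat (Uf A B U₀ t₁ P Q) (Vf A B U₀ V₀ t₁ P Q) t)ᴴ * Jmat n *
          Ymat (Uf A B U₀ t₁ P Q) (Vf A B U₀ V₀ t₁ P Q) t = 0) ↔
      (Pᴴ * Q).IsHermitian) := by
  have hH : ∀ t, (C t - (lam : ℂ) • W t).IsHermitian := fun t => by
    refine (hC t).sub ?_
    rw [Matrix.IsHermitian, conjTranspose_smul, (hW t).isHermitian.eq]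
    simp
  have hUV : ∀ t, (U₀ t)ᴴ * V₀ t = (V₀ t)ᴴ * U₀ t := fun t => by
    have h := hprep t
    rw [Ymat_form, sub_eq_zero] at h
    exact h.symm
  have hS : ∀ P Q t, t₁ ≤ t → P + S0 A B U₀ t₁ (t + 1) * Q =
      P + S0 A B U₀ t₁ t * Q +
        (U₀ (t + 1))⁻¹ * (1 - A t)⁻¹ * B t * ((U₀ t)⁻¹)ᴴ * Q := fun P Q t ht => by
    rw [S0, Finset.sum_Ico_succ_top ht, add_mul, ← add_assoc, ← S0]
  have hstep : ∀ P Q t, t₁ ≤ t →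
      (1 - A t) * Uf A B U₀ t₁ P Q (t + 1)
        = Uf A B U₀ t₁ P Q t + B t * Vf A B U₀ V₀ t₁ P Q t ∧
      Vf A B U₀ V₀ t₁ P Q (t + 1)
        = (C t - (lam : ℂ) • W t) * Uf A B U₀ t₁ P Q (t + 1)
          + (1 - A t)ᴴ * Vf A B U₀ V₀ t₁ P Q t := fun P Q t ht => by
    obtain ⟨h1, h2⟩ := hamiltonian_step_iff.1 (hY₀ t)
    simp only [Uf, Vf, hS P Q t ht]
    exact reduction_of_order_step _ Q (hA t) (hB t).isHermitian (hU₀ t ht)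
      (hU₀ (t + 1) (by omega)) (hUV t) h1 h2
  have hdet := (Matrix.isUnit_iff_isUnit_det _).1 (hU₀ t₁ le_rfl)
  have hinv : ((U₀ t₁)⁻¹)ᴴ * (U₀ t₁)ᴴ = 1 := by
    rw [← conjTranspose_mul, Matrix.mul_nonsing_inv _ hdet, conjTranspose_one]
  have hinv' : (U₀ t₁)ᴴ * ((U₀ t₁)⁻¹)ᴴ = 1 := by
    rw [← conjTranspose_mul, Matrix.nonsing_inv_mul _ hdet, conjTranspose_one]
  have hUf₁ : ∀ P Q, Uf A B U₀ t₁ P Q t₁ = U₀ t₁ * P := fun P Q => by simp [Uf, S0]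
  have hVf₁ : ∀ P Q, Vf A B U₀ V₀ t₁ P Q t₁ = V₀ t₁ * P + ((U₀ t₁)⁻¹)ᴴ * Q :=
    fun P Q => by simp [Vf, S0]
  refine ⟨fun U V hY => ⟨?_, ?_⟩,
    fun P Q t ht => hamiltonian_step_iff.2 (hstep P Q t ht), fun P Q => ?_⟩
  · have h0 : ∀ t, (U₀ t)ᴴ * V t - (V₀ t)ᴴ * U t = (U₀ 0)ᴴ * V 0 - (V₀ 0)ᴴ * U 0 := by
      intro t
      induction t with
      | zero => rfl
      | succ t ih =>
        obtain ⟨h1, h2⟩ := hamiltonian_step_iff.1 (hY₀ t)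
        obtain ⟨h3, h4⟩ := hamiltonian_step_iff.1 (hY t)
        rw [← ih, wronskian_step (hB t).isHermitian (hH t) h1 h2 h3 h4]
    exact fun s t => (h0 s).trans (h0 t).symm
  · intro t ht
    induction t, ht using Nat.le_induction with
    | base =>
      have hV₀ : V₀ t₁ * (U₀ t₁)⁻¹ = ((U₀ t₁)⁻¹)ᴴ * (V₀ t₁)ᴴ := by
        calc V₀ t₁ * (U₀ t₁)⁻¹
            = ((U₀ t₁)⁻¹)ᴴ * ((U₀ t₁)ᴴ * V₀ t₁) * (U₀ t₁)⁻¹ := by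
              rw [← mul_assoc, hinv, one_mul]
          _ = ((U₀ t₁)⁻¹)ᴴ * (V₀ t₁)ᴴ := by
              rw [hUV, ← mul_assoc, Matrix.mul_nonsing_inv_cancel_right _ _ hdet]
      rw [hUf₁, hVf₁, Matrix.mul_nonsing_inv_cancel_left _ _ hdet]
      refine ⟨rfl, ?_⟩
      rw [mul_sub, ← mul_assoc, ← mul_assoc, ← mul_assoc, hinv, hV₀, one_mul]
      abel
    | succ t ht ih =>
      obtain ⟨h1, h2⟩ := hamiltonian_step_iff.1 (hY t)
      obtain ⟨h3, h4⟩ := hstep ((U₀ t₁)⁻¹ * U t₁)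
        ((U₀ t₁)ᴴ * V t₁ - (V₀ t₁)ᴴ * U t₁) t ht
      rw [← ih.1, ← ih.2, ← h1] at h3
      have hU := ((hA t).mul_left_cancel h3).symm
      rw [← ih.2, ← hU, ← h2] at h4
      exact ⟨hU, h4.symm⟩
  · have hconst : ∀ t, t₁ ≤ t →
        (Uf A B U₀ t₁ P Q t)ᴴ * Vf A B U₀ V₀ t₁ P Q t
          - (Vf A B U₀ V₀ t₁ P Q t)ᴴ * Uf A B U₀ t₁ P Q t = Pᴴ * Q - Qᴴ * P := by
      intro t ht
      induction t, ht using Nat.le_induction with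
      | base =>
        rw [hUf₁, hVf₁]
        simp only [conjTranspose_mul, conjTranspose_add, conjTranspose_conjTranspose]
        calc _ = Pᴴ * ((U₀ t₁)ᴴ * V₀ t₁) * P + Pᴴ * ((U₀ t₁)ᴴ * ((U₀ t₁)⁻¹)ᴴ) * Q
              - (Pᴴ * ((V₀ t₁)ᴴ * U₀ t₁) * P + Qᴴ * ((U₀ t₁)⁻¹ * U₀ t₁) * P) := by
              simp only [mul_assoc, mul_add, add_mul]
          _ = _ := by
              rw [hinv', Matrix.nonsing_inv_mul _ hdet, hUV, mul_one, mul_one]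
              abel
      | succ t ht ih =>
        obtain ⟨h1, h2⟩ := hstep P Q t ht
        rw [← ih, wronskian_step (hB t).isHermitian (hH t) h1 h2 h1 h2]
    have hform : ∀ t, t₁ ≤ t →
        ((Ymat (Uf A B U₀ t₁ P Q) (Vf A B U₀ V₀ t₁ P Q) t)ᴴ * Jmat n *
          Ymat (Uf A B U₀ t₁ P Q) (Vf A B U₀ V₀ t₁ P Q) t = 0 ↔
        (Pᴴ * Q).IsHermitian) := fun t ht => by
      rw [Ymat_form, ← neg_eq_zero, neg_sub, hconst t ht, sub_eq_zero, Matrix.IsHermitian,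
        conjTranspose_mul, conjTranspose_conjTranspose, eq_comm]
    exact ⟨fun h => (hform t₁ le_rfl).1 (h t₁ le_rfl), fun h t ht => (hform t ht).2 h⟩
end
end

section
/- Let λ ∈ ℝ and let Y = (U; V) be a dominant solution of system (1.1) with U(t) invertible for all t ≥ t₁, and set S(t) := Σ_{s=t}^{∞} U^{−1}(s+1)Ã(s)B(s)(U^{−1})*(s) for t ≥ t₁. Define U₀(t) := U(t)S(t) and V₀(t) := V(t)S(t) − (U^{−1})*(t) for t ≥ t₁. Then (U₀; V₀) satisfies the equations of (1.1) for t ≥ t₁, and its unique extension to a matrix solution on all of ℕ is a recessive solution of (1.1). -/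
open Matrix Filter
open scoped ComplexOrder Topology

noncomputable section

/-- `Y = (U; V)` is a recessive (principal) solution of (1.1): it is a prepared
matrix solution such that whenever `Y₁ = (U₁; V₁)` is a matrix solution with
`Y*(t) J Y₁(t) ≡ C` a constant invertible matrix, there is `t₁` with `U₁(t)`
invertible for `t ≥ t₁` and `U₁⁻¹(t)U(t) → 0` as `t → ∞`. -/
def IsRecessive {n : ℕ} (A B C W : ℕ → Matrix (Fin n) (Fin n) ℂ) (lam : ℂ)
    (U V : ℕ → Matrix (Fin n) (Fin n) ℂ) : Prop :=
  IsMatSol A B C W lam U V ∧ IsPrepared U V ∧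
  ∀ U₁ V₁ : ℕ → Matrix (Fin n) (Fin n) ℂ, IsMatSol A B C W lam U₁ V₁ →
    (∃ Cm : Matrix (Fin n) (Fin n) ℂ, IsUnit Cm ∧
      ∀ t : ℕ, (Ymat U V t)ᴴ * Jmat n * Ymat U₁ V₁ t = Cm) →
    ∃ t₁ : ℕ, (∀ t, t₁ ≤ t → IsUnit (U₁ t)) ∧
      Tendsto (fun t => (U₁ t)⁻¹ * U t) atTop (nhds 0)

/-- The Wronskian `Y₁* J Y₂` in block form. -/
lemma Ymat_wronskian {n : ℕ} (U₁ V₁ U₂ V₂ : ℕ → Matrix (Fin n) (Fin n) ℂ) (t : ℕ) :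
    (Ymat U₁ V₁ t)ᴴ * Jmat n * Ymat U₂ V₂ t = (V₁ t)ᴴ * U₂ t - (U₁ t)ᴴ * V₂ t := by
  have h (U V : ℕ → Matrix (Fin n) (Fin n) ℂ) : Ymat U V t = fromRows (U t) (V t) := by
    ext i j
    cases i <;> rfl
  rw [h, h, conjTranspose_fromRows_eq_fromCols_conjTranspose, Jmat,
    fromCols_mul_fromBlocks, fromCols_mul_fromRows]
  simp [sub_eq_add_neg]

lemma IsMatSol.one_sub_mul {n : ℕ} {A B C W U V : ℕ → Matrix (Fin n) (Fin n) ℂ} {lam : ℂ}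
    (h : IsMatSol A B C W lam U V) (t : ℕ) :
    (1 - A t) * U (t + 1) = U t + B t * V t := by
  have := (h t).1
  rw [sub_mul, one_mul]
  linear_combination (norm := abel) this

lemma IsMatSol.right_succ {n : ℕ} {A B C W U V : ℕ → Matrix (Fin n) (Fin n) ℂ} {lam : ℂ}
    (h : IsMatSol A B C W lam U V) (t : ℕ) :
    V (t + 1) = (C t - lam • W t) * U (t + 1) + (1 - A t)ᴴ * V t := by
  have := (h t).2
  rw [sub_eq_iff_eq_add] at this
  rw [this, conjTranspose_sub, conjTranspose_one, sub_mul 1, one_mul]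
  abel

/-- For real `λ` the Wronskian of two matrix solutions is constant. -/
lemma IsMatSol.wronskian_eq {n : ℕ} {A B C W U₁ V₁ U₂ V₂ : ℕ → Matrix (Fin n) (Fin n) ℂ}
    {lam : ℝ} (hB : ∀ t, (B t).IsHermitian) (hC : ∀ t, (C t).IsHermitian)
    (hW : ∀ t, (W t).IsHermitian) (h₁ : IsMatSol A B C W (lam : ℂ) U₁ V₁)
    (h₂ : IsMatSol A B C W (lam : ℂ) U₂ V₂) (s t : ℕ) :
    (V₁ s)ᴴ * U₂ s - (U₁ s)ᴴ * V₂ s = (V₁ t)ᴴ * U₂ t - (U₁ t)ᴴ * V₂ t := by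
  suffices H : ∀ t, (V₁ t)ᴴ * U₂ t - (U₁ t)ᴴ * V₂ t = (V₁ 0)ᴴ * U₂ 0 - (U₁ 0)ᴴ * V₂ 0 by
    rw [H s, H t]
  intro t
  induction t with
  | zero => rfl
  | succ t ih =>
    have hG : (C t - (lam : ℂ) • W t)ᴴ = C t - (lam : ℂ) • W t := by
      simp [(hC t).eq, (hW t).eq]
    calc _ = (V₁ t)ᴴ * ((1 - A t) * U₂ (t + 1)) - ((1 - A t) * U₁ (t + 1))ᴴ * V₂ t := by
          rw [h₁.right_succ, h₂.right_succ, conjTranspose_add, conjTranspose_mul, hG,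
            conjTranspose_mul, conjTranspose_mul, conjTranspose_conjTranspose]
          generalize C t - (lam : ℂ) • W t = G
          noncomm_ring
      _ = (V₁ t)ᴴ * U₂ t - (U₁ t)ᴴ * V₂ t := by
          rw [h₁.one_sub_mul, h₂.one_sub_mul, conjTranspose_add, conjTranspose_mul, (hB t).eq]
          noncomm_ring
      _ = _ := ih

/-- For an invertible `U`, if `V* U` is Hermitian then so is `V U⁻¹`. -/
lemma mul_inv_eq_of_conjTranspose_mul_eq {n : ℕ} {U V : Matrix (Fin n) (Fin n) ℂ}
    (hU : IsUnit U) (hUV : Vᴴ * U = Uᴴ * V) : V * U⁻¹ = (U⁻¹)ᴴ * Vᴴ := by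
  have hd := (isUnit_iff_isUnit_det U).1 hU
  have e : (U⁻¹)ᴴ * Uᴴ = 1 := by
    rw [← conjTranspose_mul, mul_nonsing_inv U hd, conjTranspose_one]
  calc V * U⁻¹ = (U⁻¹)ᴴ * Uᴴ * V * U⁻¹ := by rw [e, one_mul]
    _ = (U⁻¹)ᴴ * (Vᴴ * U) * U⁻¹ := by rw [hUV, mul_assoc (U⁻¹)ᴴ]
    _ = (U⁻¹)ᴴ * Vᴴ := by rw [← mul_assoc, mul_nonsing_inv_cancel_right _ _ hd]

/-- If `U` and `N = U + B V` are invertible and `B`, `V* U` are Hermitian, then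
`N⁻¹ B (U⁻¹)*` is Hermitian. -/
lemma isHermitian_inv_mul_mul_inv {n : ℕ} {B U V N : Matrix (Fin n) (Fin n) ℂ}
    (hB : B.IsHermitian) (hU : IsUnit U) (hN : IsUnit N) (hNUV : N = U + B * V)
    (hUV : Vᴴ * U = Uᴴ * V) : (N⁻¹ * B * (U⁻¹)ᴴ).IsHermitian := by
  have hQ := mul_inv_eq_of_conjTranspose_mul_eq hU hUV
  have hUd := (isUnit_iff_isUnit_det U).1 hU
  have hNd := (isUnit_iff_isUnit_det N).1 hN
  have hQh : ((U⁻¹)ᴴ * Vᴴ).IsHermitian := by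
    rw [IsHermitian, conjTranspose_mul, conjTranspose_conjTranspose, conjTranspose_conjTranspose,
      hQ]
  have e : (U⁻¹)ᴴ * Uᴴ = 1 := by
    rw [← conjTranspose_mul, mul_nonsing_inv U hUd, conjTranspose_one]
  have e' : Nᴴ * (N⁻¹)ᴴ = 1 := by
    rw [← conjTranspose_mul, nonsing_inv_mul N hNd, conjTranspose_one]
  have key : N⁻¹ * B * (U⁻¹)ᴴ = N⁻¹ * (B + B * ((U⁻¹)ᴴ * Vᴴ) * B) * (N⁻¹)ᴴ := by
    have : B + B * ((U⁻¹)ᴴ * Vᴴ) * B = B * (U⁻¹)ᴴ * Nᴴ := by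
      rw [hNUV, conjTranspose_add, conjTranspose_mul, hB.eq, mul_add, mul_assoc B _ Uᴴ, e, mul_one]
      simp only [mul_assoc]
    rw [this]
    calc N⁻¹ * B * (U⁻¹)ᴴ = N⁻¹ * B * (U⁻¹)ᴴ * (Nᴴ * (N⁻¹)ᴴ) := by rw [e', mul_one]
      _ = _ := by simp only [mul_assoc]
  rw [key]
  refine isHermitian_mul_mul_conjTranspose _ (hB.add ?_)
  have := isHermitian_mul_mul_conjTranspose B hQh
  rwa [hB.eq] at this

/-- If `U` and `N = U + B V` are invertible and `B`, `V* U` are Hermitian, then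
`V N⁻¹ B (U⁻¹)* = (U⁻¹)* - (N⁻¹)*`. -/
lemma mul_inv_mul_mul_inv {n : ℕ} {B U V N : Matrix (Fin n) (Fin n) ℂ}
    (hB : B.IsHermitian) (hU : IsUnit U) (hN : IsUnit N) (hNUV : N = U + B * V)
    (hUV : Vᴴ * U = Uᴴ * V) : V * (N⁻¹ * B * (U⁻¹)ᴴ) = (U⁻¹)ᴴ - (N⁻¹)ᴴ := by
  have hQ := mul_inv_eq_of_conjTranspose_mul_eq hU hUV
  have hUd := (isUnit_iff_isUnit_det U).1 hU
  have hNd := (isUnit_iff_isUnit_det N).1 hN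
  have e : (U⁻¹)ᴴ * Uᴴ = 1 := by
    rw [← conjTranspose_mul, mul_nonsing_inv U hUd, conjTranspose_one]
  have e' : Nᴴ * (N⁻¹)ᴴ = 1 := by
    rw [← conjTranspose_mul, nonsing_inv_mul N hNd, conjTranspose_one]
  have hVB : Vᴴ * B = Nᴴ - Uᴴ := by
    rw [hNUV, conjTranspose_add, conjTranspose_mul, hB.eq, add_sub_cancel_left]
  rw [← (isHermitian_inv_mul_mul_inv hB hU hN hNUV hUV).eq, conjTranspose_mul, conjTranspose_mul,
    conjTranspose_conjTranspose, hB.eq, ← mul_assoc, hQ, ← mul_assoc, mul_assoc _ Vᴴ, hVB,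
    mul_sub, e, sub_mul, mul_assoc, e', mul_one, one_mul]

/-- If `S t → 0` and `M` is invertible, then `S t * D - M` is eventually invertible and
`(S t * D - M)⁻¹ * S t → 0`. -/
lemma eventually_isUnit_and_tendsto_inv_mul {n : ℕ} {S : ℕ → Matrix (Fin n) (Fin n) ℂ}
    (hS : Tendsto S atTop (𝓝 0)) (D : Matrix (Fin n) (Fin n) ℂ) {M : Matrix (Fin n) (Fin n) ℂ}
    (hM : IsUnit M) :
    (∀ᶠ t in atTop, IsUnit (S t * D - M)) ∧
      Tendsto (fun t => (S t * D - M)⁻¹ * S t) atTop (𝓝 0) := by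
  have hdet : (-M).det ≠ 0 := ((isUnit_iff_isUnit_det (-M)).1 hM.neg).ne_zero
  have hlim : Tendsto (fun t => S t * D - M) atTop (𝓝 (-M)) := by
    simpa using (hS.mul_const D).sub_const M
  have hcd : Continuous fun X : Matrix (Fin n) (Fin n) ℂ => X.det := continuous_id.matrix_det
  constructor
  · filter_upwards [((hcd.tendsto _).comp hlim).eventually_ne hdet] with t ht
    exact (isUnit_iff_isUnit_det _).2 (isUnit_iff_ne_zero.2 ht)
  · have hinv : ContinuousAt Inv.inv (-M) := by
      refine continuousAt_matrix_inv _ ?_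
      rw [Ring.inverse_eq_inv']
      exact continuousAt_inv₀ hdet
    simpa using (hinv.tendsto.comp hlim).mul hS

/-- Let `λ ∈ ℝ` and `Y = (U; V)` be a dominant solution of (1.1)
with `U(t)` invertible for `t ≥ t₁`, and let
`S(t) = Σ_{s=t}^{∞} U⁻¹(s+1)Ã(s)B(s)(U⁻¹)*(s)`. Then
`U₀(t) := U(t)S(t)`, `V₀(t) := V(t)S(t) − (U⁻¹)*(t)` satisfy the equations of
(1.1) for `t ≥ t₁`, and any matrix solution on all of `ℕ` extending `(U₀; V₀)`
is a recessive solution of (1.1). -/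
theorem dominant_to_recessive (n : ℕ) (hn : 0 < n)
    (A B C W : ℕ → Matrix (Fin n) (Fin n) ℂ)
    (hA : ∀ t, IsUnit (1 - A t))
    (hB : ∀ t, (B t).PosSemidef)
    (hC : ∀ t, (C t).IsHermitian)
    (hW : ∀ t, (W t).PosSemidef)
    (lam : ℝ) (t₁ : ℕ)
    (U V : ℕ → Matrix (Fin n) (Fin n) ℂ)
    (hY : IsMatSol A B C W (lam : ℂ) U V)
    (hprep : IsPrepared U V)
    (hU : ∀ t, t₁ ≤ t → IsUnit (U t))
    (hsum : Summable fun s : ℕ =>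
      (U (t₁ + s + 1))⁻¹ * (1 - A (t₁ + s))⁻¹ * B (t₁ + s) * ((U (t₁ + s))⁻¹)ᴴ) :
    -- `S`, `U₀`, `V₀` as in the statement
    ∀ S U₀ V₀ : ℕ → Matrix (Fin n) (Fin n) ℂ,
      (∀ t, S t = ∑' s : ℕ,
        (U (t + s + 1))⁻¹ * (1 - A (t + s))⁻¹ * B (t + s) * ((U (t + s))⁻¹)ᴴ) →
      (∀ t, U₀ t = U t * S t) →
      (∀ t, V₀ t = V t * S t - ((U t)⁻¹)ᴴ) →
      -- `(U₀; V₀)` satisfies the equations of (1.1) on `[t₁, ∞)`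
      ((∀ t, t₁ ≤ t →
        U₀ (t + 1) - U₀ t = A t * U₀ (t + 1) + B t * V₀ t ∧
        V₀ (t + 1) - V₀ t = (C t - (lam : ℂ) • W t) * U₀ (t + 1)
          - (A t)ᴴ * V₀ t) ∧
      -- any matrix solution on `ℕ` extending `(U₀; V₀)` is recessive
      (∀ U₂ V₂ : ℕ → Matrix (Fin n) (Fin n) ℂ,
        IsMatSol A B C W (lam : ℂ) U₂ V₂ →
        (∀ t, t₁ ≤ t → U₂ t = U₀ t ∧ V₂ t = V₀ t) →
        IsRecessive A B C W (lam : ℂ) U₂ V₂)) := by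
  intro S U₀ V₀ hS hU₀ hV₀
  set K : ℕ → Matrix (Fin n) (Fin n) ℂ := fun t =>
    (U (t + 1))⁻¹ * (1 - A t)⁻¹ * B t * ((U t)⁻¹)ᴴ with hKdef
  have hBh t := (hB t).isHermitian
  have hUd t (ht : t₁ ≤ t) : IsUnit (U t).det := (isUnit_iff_isUnit_det _).1 (hU t ht)
  have hAd t : IsUnit (1 - A t).det := (isUnit_iff_isUnit_det _).1 (hA t)
  have hUV t : (V t)ᴴ * U t = (U t)ᴴ * V t := by
    rw [← sub_eq_zero, ← Ymat_wronskian]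
    exact hprep t
  have hN t (ht : t₁ ≤ t) : IsUnit ((1 - A t) * U (t + 1)) := (hA t).mul (hU _ (by omega))
  have hK t : K t = ((1 - A t) * U (t + 1))⁻¹ * B t * ((U t)⁻¹)ᴴ := by
    rw [Matrix.mul_inv_rev]
  have hKh t (ht : t₁ ≤ t) : (K t).IsHermitian := by
    rw [hK]
    exact isHermitian_inv_mul_mul_inv (hBh t) (hU t ht) (hN t ht) (hY.one_sub_mul t) (hUV t)
  have hNK t (ht : t₁ ≤ t) : (1 - A t) * U (t + 1) * K t = B t * ((U t)⁻¹)ᴴ := by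
    rw [hK, mul_assoc _ (B t), mul_nonsing_inv_cancel_left _ _
      ((isUnit_iff_isUnit_det _).1 (hN t ht))]
  have hVK t (ht : t₁ ≤ t) :
      (1 - A t)ᴴ * (V t * K t) = (1 - A t)ᴴ * ((U t)⁻¹)ᴴ - ((U (t + 1))⁻¹)ᴴ := by
    rw [hK, mul_inv_mul_mul_inv (hBh t) (hU t ht) (hN t ht) (hY.one_sub_mul t) (hUV t), mul_sub,
      ← conjTranspose_mul ((1 - A t) * U (t + 1))⁻¹, Matrix.mul_inv_rev,
      nonsing_inv_mul_cancel_right _ _ (hAd t)]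
  have hKsum : Summable K := by
    rw [← summable_nat_add_iff t₁]
    simpa only [hKdef, add_comm t₁] using hsum
  have hSK t : S t = ∑' s, K (s + t) := by
    simp only [hS, hKdef, add_comm t]
  have hSsucc t : S t = S (t + 1) + K t := by
    rw [hSK, hSK, ((summable_nat_add_iff t).2 hKsum).tsum_eq_zero_add, zero_add, add_comm]
    simp only [add_assoc, add_comm 1]
  have hS0 : Tendsto S atTop (𝓝 0) := by
    rw [funext hSK]
    exact tendsto_sum_nat_add K
  have hSh t (ht : t₁ ≤ t) : (S t)ᴴ = S t := by
    rw [hSK, conjTranspose_tsum]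
    exact tsum_congr fun s => (hKh (s + t) (by omega)).eq
  refine ⟨fun t ht => ⟨?_, ?_⟩, fun U₂ V₂ h₂ hext => ?_⟩
  · have h : (1 - A t) * U₀ (t + 1) = U₀ t + B t * V₀ t := by
      rw [hU₀, hU₀, hV₀, hSsucc t, mul_sub, ← hNK t ht, ← mul_assoc (B t),
        ← sub_eq_iff_eq_add'.2 (hY.one_sub_mul t)]
      noncomm_ring
    rw [sub_mul, one_mul] at h
    linear_combination (norm := abel) h
  · have h : V₀ (t + 1) = (C t - (lam : ℂ) • W t) * U₀ (t + 1) + (1 - A t)ᴴ * V₀ t := by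
      rw [hU₀, hV₀, hV₀, hSsucc t, hY.right_succ, mul_add (V t), mul_sub, mul_add, hVK t ht]
      generalize C t - (lam : ℂ) • W t = G
      noncomm_ring
    rw [h, conjTranspose_sub, conjTranspose_one, sub_mul 1, one_mul]
    abel
  · have hW' t := (hW t).isHermitian
    have hUUinv t (ht : t₁ ≤ t) : (U t)ᴴ * ((U t)⁻¹)ᴴ = 1 := by
      rw [← conjTranspose_mul, nonsing_inv_mul _ (hUd t ht), conjTranspose_one]
    have hw t (ht : t₁ ≤ t) (X Z : Matrix (Fin n) (Fin n) ℂ) :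
        (V₂ t)ᴴ * X - (U₂ t)ᴴ * Z = S t * ((V t)ᴴ * X - (U t)ᴴ * Z) - (U t)⁻¹ * X := by
      rw [(hext t ht).1, (hext t ht).2, hU₀, hV₀, conjTranspose_sub, conjTranspose_mul,
        conjTranspose_mul, conjTranspose_conjTranspose, hSh t ht]
      noncomm_ring
    refine ⟨h₂, fun t => ?_, fun U₃ V₃ h₃ ⟨M, hM, hw₃⟩ => ?_⟩
    · rw [Ymat_wronskian, h₂.wronskian_eq hBh hC hW' h₂ t t₁, hw t₁ le_rfl, (hext t₁ le_rfl).1,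
        (hext t₁ le_rfl).2, hU₀, hV₀, mul_sub (U t₁)ᴴ, hUUinv t₁ le_rfl, ← mul_assoc (V t₁)ᴴ,
        ← mul_assoc (U t₁)ᴴ, hUV,
        nonsing_inv_mul_cancel_left _ _ (hUd t₁ le_rfl)]
      simp
    · have hU₃ t (ht : t₁ ≤ t) :
          U₃ t = U t * (S t * ((V t₁)ᴴ * U₃ t₁ - (U t₁)ᴴ * V₃ t₁) - M) := by
        rw [← hw₃ t, Ymat_wronskian, hw t ht, hY.wronskian_eq hBh hC hW' h₃ t t₁, sub_sub_cancel,
          mul_nonsing_inv_cancel_left _ _ (hUd t ht)]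
      obtain ⟨hev, hlim⟩ := eventually_isUnit_and_tendsto_inv_mul hS0
        ((V t₁)ᴴ * U₃ t₁ - (U t₁)ᴴ * V₃ t₁) hM
      obtain ⟨t₂, ht₂⟩ := eventually_atTop.1 hev
      refine ⟨max t₁ t₂, fun t ht => ?_, hlim.congr' ?_⟩
      · rw [hU₃ t (le_of_max_le_left ht)]
        exact (hU t (le_of_max_le_left ht)).mul (ht₂ t (le_of_max_le_right ht))
      · filter_upwards [eventually_ge_atTop t₁] with t ht
        rw [hU₃ t ht, (hext t ht).1, hU₀, Matrix.mul_inv_rev, mul_assoc,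
          nonsing_inv_mul_cancel_left _ _ (hUd t ht)]
end
end

section
/- Let λ₀ ∈ ℝ. If system (1.1) has the unique two point property on ℕ at λ = λ₀, then (1.1) is identically normal on ℕ. -/
open Matrix
open scoped ComplexOrder

noncomputable section

/-- `y = (u; v)` is a (vector) solution of (1.1). -/
def IsSol {n : ℕ} (A B C W : ℕ → Matrix (Fin n) (Fin n) ℂ) (lam : ℂ)
    (u v : ℕ → Fin n → ℂ) : Prop :=
  ∀ t : ℕ,
    u (t + 1) - u t = A t *ᵥ u (t + 1) + B t *ᵥ v t ∧
    v (t + 1) - v t = (C t - lam • W t) *ᵥ u (t + 1) - (A t)ᴴ *ᵥ v t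

/-- System (1.1) is identically normal on `ℕ`. -/
def IdenticallyNormal {n : ℕ} (A B : ℕ → Matrix (Fin n) (Fin n) ℂ) : Prop :=
  ∀ a b : ℕ, a < b → ∀ v : ℕ → Fin n → ℂ,
    (∀ t, a ≤ t → t < b → v (t + 1) - v t = -((A t)ᴴ *ᵥ v t)) →
    (∀ t, a ≤ t → t ≤ b → B t *ᵥ v t = 0) →
    ∀ t, a ≤ t → t ≤ b → v t = 0

/-- System (1.1) has the unique two point property on `ℕ` at `λ = λ₀`. -/
def UniqueTwoPoint {n : ℕ} (A B C W : ℕ → Matrix (Fin n) (Fin n) ℂ)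
    (lam₀ : ℂ) : Prop :=
  ∀ u₁ v₁ u₂ v₂ : ℕ → Fin n → ℂ,
    IsSol A B C W lam₀ u₁ v₁ → IsSol A B C W lam₀ u₂ v₂ →
    ∀ s₁ s₂ : ℕ, s₁ < s₂ → u₁ s₁ = u₂ s₁ → u₁ s₂ = u₂ s₂ →
    ∀ t : ℕ, u₁ t = u₂ t ∧ v₁ t = v₂ t

/-- A sequence of relations that can be followed both forwards and backwards admits a trajectory
through any prescribed point at any prescribed time. -/
theorem exists_trajectory_through {α : Type*} (R : ℕ → α → α → Prop)
    (hfwd : ∀ t x, ∃ y, R t x y) (hbwd : ∀ t y, ∃ x, R t x y) (a : ℕ) (x : α) :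
    ∃ f : ℕ → α, f a = x ∧ ∀ t, R t (f t) (f (t + 1)) := by
  induction a generalizing R with
  | zero =>
    choose F hF using hfwd
    exact ⟨fun t => Nat.rec x F t, rfl, fun t => hF t _⟩
  | succ a ih =>
    obtain ⟨g, hga, hg⟩ := ih (fun t => R (t + 1)) (fun t => hfwd (t + 1)) (fun t => hbwd (t + 1))
    obtain ⟨y, hy⟩ := hbwd 0 (g 0)
    refine ⟨fun t => Nat.casesOn t y g, hga, fun t => ?_⟩
    cases t with
    | zero => exact hy
    | succ t => exact hg t

/-- System (1.1) has a solution through any initial value at any time. -/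
theorem exists_isSol_through {n : ℕ} (A B C W : ℕ → Matrix (Fin n) (Fin n) ℂ)
    (hA : ∀ t, IsUnit (1 - A t)) (lam : ℂ) (a : ℕ) (u₀ v₀ : Fin n → ℂ) :
    ∃ u v : ℕ → Fin n → ℂ, IsSol A B C W lam u v ∧ u a = u₀ ∧ v a = v₀ := by
  have hAH (t : ℕ) : IsUnit (1 - (A t)ᴴ) := by
    simpa [star_eq_conjTranspose] using (hA t).star
  obtain ⟨f, hfa, hf⟩ := exists_trajectory_through
    (fun t (x y : (Fin n → ℂ) × (Fin n → ℂ)) =>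
      y.1 - x.1 = A t *ᵥ y.1 + B t *ᵥ x.2 ∧
      y.2 - x.2 = (C t - lam • W t) *ᵥ y.1 - (A t)ᴴ *ᵥ x.2)
    (fun t x => by
      obtain ⟨u, hu⟩ := mulVec_surjective_iff_isUnit.mpr (hA t) (x.1 + B t *ᵥ x.2)
      refine ⟨(u, x.2 + ((C t - lam • W t) *ᵥ u - (A t)ᴴ *ᵥ x.2)), ?_, by simp⟩
      rw [sub_mulVec, one_mulVec] at hu
      linear_combination hu)
    (fun t y => by
      obtain ⟨v, hv⟩ := mulVec_surjective_iff_isUnit.mpr (hAH t)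
        (y.2 - (C t - lam • W t) *ᵥ y.1)
      refine ⟨(y.1 - (A t *ᵥ y.1 + B t *ᵥ v), v), by simp, ?_⟩
      rw [sub_mulVec, one_mulVec] at hv
      linear_combination -hv)
    a (u₀, v₀)
  exact ⟨fun t => (f t).1, fun t => (f t).2, hf, by simp [hfa], by simp [hfa]⟩

/-- if (1.1) has the unique two point property on `ℕ` at
`λ = λ₀`, then (1.1) is identically normal on `ℕ`. -/
theorem utp_implies_identically_normal (n : ℕ) (hn : 0 < n)
    (A B C W : ℕ → Matrix (Fin n) (Fin n) ℂ)
    (hA : ∀ t, IsUnit (1 - A t))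
    (hB : ∀ t, (B t).PosSemidef)
    (hC : ∀ t, (C t).IsHermitian)
    (hW : ∀ t, (W t).PosSemidef)
    (lam₀ : ℝ)
    (hutp : UniqueTwoPoint A B C W (lam₀ : ℂ)) :
    IdenticallyNormal A B := by
  intro a b hab v hv hBv
  obtain ⟨U, V, hUV, hUa, hVa⟩ := exists_isSol_through A B C W hA lam₀ a 0 (v a)
  have hU : U (a + 1) = 0 := by
    have h := (hUV a).1
    rw [hUa, hVa, hBv a le_rfl hab.le, sub_zero, add_zero] at h
    apply mulVec_injective_iff_isUnit.mpr (hA a)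
    rw [sub_mulVec, one_mulVec, mulVec_zero, ← h, sub_self]
  have hzero : IsSol A B C W (lam₀ : ℂ) (fun _ => 0) (fun _ => 0) := fun t => by simp
  have hva : v a = 0 :=
    hVa ▸ (hutp U V _ _ hUV hzero a (a + 1) a.lt_succ_self hUa hU a).2
  intro t hat
  induction t, hat using Nat.le_induction with
  | base => exact fun _ => hva
  | succ t hat ih =>
    intro htb
    have h := hv t hat htb
    rwa [ih (Nat.le_of_succ_le htb), mulVec_zero, neg_zero, sub_zero] at h
end
end

section
/- Let u₁, v₁, u₂, v₂, u₁′ : ℕ → ℂⁿ be such that the pair y₁ = (u₁; v₁) together with u₁′ satisfies the nonhomogeneous system (3.5), and y₂ = (u₂; v₂) satisfies Δu₂(t) = A(t)u₂(t+1) + B(t)v₂(t) for all t ∈ ℕ. Then for all s, k ∈ ℕ with s ≤ k: Σ_{t=s}^{k} u₂*(t+1)W(t)u₁′(t+1) = Σ_{t=s}^{k} [u₂*(t+1)C(t)u₁(t+1) + v₂*(t)B(t)v₁(t)] − (u₂*(k+1)v₁(k+1) − u₂*(s)v₁(s)). -/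
open Matrix
open scoped ComplexOrder

noncomputable section

/-- The Lagrange-type identity behind `nonhomogeneous_sum_identity`, at a single time. -/
lemma star_dotProduct_sub_star_dotProduct {m : Type*} [Fintype m] {A B C W : Matrix m m ℂ}
    (hB : B.IsHermitian) {x v v' y y' w f : m → ℂ}
    (hv : v' - v = C *ᵥ x - Aᴴ *ᵥ v - W *ᵥ f)
    (hy : y' - y = A *ᵥ y' + B *ᵥ w) :
    star y' ⬝ᵥ v' - star y ⬝ᵥ v
      = star y' ⬝ᵥ (C *ᵥ x) + star w ⬝ᵥ (B *ᵥ v) - star y' ⬝ᵥ (W *ᵥ f) := by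
  have hdiff : star y' ⬝ᵥ v - star y ⬝ᵥ v
      = star y' ⬝ᵥ (Aᴴ *ᵥ v) + star w ⬝ᵥ (B *ᵥ v) := by
    rw [← sub_dotProduct, ← star_sub, hy, star_add, star_mulVec, star_mulVec, hB.eq,
      add_dotProduct, dotProduct_mulVec, dotProduct_mulVec]
  have hstep : star y' ⬝ᵥ v' - star y' ⬝ᵥ v
      = star y' ⬝ᵥ (C *ᵥ x) - star y' ⬝ᵥ (Aᴴ *ᵥ v) - star y' ⬝ᵥ (W *ᵥ f) := by
    rw [← dotProduct_sub, hv, dotProduct_sub, dotProduct_sub]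
  linear_combination hdiff + hstep

/-- Lemma 3.6, finite-sum form: if `y₁ = (u₁; v₁)` together
with `u₁′` satisfies the nonhomogeneous system (3.5), i.e.
`Δu₁(t) = A(t)u₁(t+1) + B(t)v₁(t)` and
`Δv₁(t) = C(t)u₁(t+1) − A*(t)v₁(t) − W(t)u₁′(t+1)`,
and `y₂ = (u₂; v₂)` satisfies `Δu₂(t) = A(t)u₂(t+1) + B(t)v₂(t)`, then for all
`s ≤ k`:
`Σ_{t=s}^{k} u₂*(t+1)W(t)u₁′(t+1)
  = Σ_{t=s}^{k} [u₂*(t+1)C(t)u₁(t+1) + v₂*(t)B(t)v₁(t)]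
    − (u₂*(k+1)v₁(k+1) − u₂*(s)v₁(s))`. -/
theorem nonhomogeneous_sum_identity (n : ℕ) (hn : 0 < n)
    (A B C W : ℕ → Matrix (Fin n) (Fin n) ℂ)
    (hA : ∀ t, IsUnit (1 - A t))
    (hB : ∀ t, (B t).PosSemidef)
    (hC : ∀ t, (C t).IsHermitian)
    (hW : ∀ t, (W t).PosSemidef)
    (u₁ v₁ u₂ v₂ u₁' : ℕ → Fin n → ℂ)
    (h₁u : ∀ t : ℕ, u₁ (t + 1) - u₁ t = A t *ᵥ u₁ (t + 1) + B t *ᵥ v₁ t)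
    (h₁v : ∀ t : ℕ, v₁ (t + 1) - v₁ t
      = C t *ᵥ u₁ (t + 1) - (A t)ᴴ *ᵥ v₁ t - W t *ᵥ u₁' (t + 1))
    (h₂u : ∀ t : ℕ, u₂ (t + 1) - u₂ t = A t *ᵥ u₂ (t + 1) + B t *ᵥ v₂ t)
    (s k : ℕ) (hsk : s ≤ k) :
    ∑ t ∈ Finset.Icc s k, star (u₂ (t + 1)) ⬝ᵥ (W t *ᵥ u₁' (t + 1))
      = ∑ t ∈ Finset.Icc s k,
          (star (u₂ (t + 1)) ⬝ᵥ (C t *ᵥ u₁ (t + 1))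
            + star (v₂ t) ⬝ᵥ (B t *ᵥ v₁ t))
        - (star (u₂ (k + 1)) ⬝ᵥ v₁ (k + 1) - star (u₂ s) ⬝ᵥ v₁ s) := by
  rw [← Finset.sum_Icc_sub hsk fun t => star (u₂ t) ⬝ᵥ v₁ t, ← Finset.sum_sub_distrib]
  refine Finset.sum_congr rfl fun t _ => ?_
  rw [star_dotProduct_sub_star_dotProduct (hB t).isHermitian (h₁v t) (h₂u t), sub_sub_cancel]
end
end

section
/- Suppose the pair y = (u; v) together with u′ satisfies the nonhomogeneous system (3.5), with u(0) = v(0) = 0 and with u(t) = v(t) = 0 for all sufficiently large t. Then Σ_{t∈ℕ} u*(t+1)W(t)u′(t+1) = Σ_{t∈ℕ} u*(t+1)C(t)u(t+1) + Σ_{t∈ℕ} v*(t)B(t)v(t), where all three sums have only finitely many nonzero terms; in particular the left-hand side is a real number. -/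
open Matrix
open scoped ComplexOrder

noncomputable section

/-- The discrete Lagrange identity for one step of a linear Hamiltonian difference system, with
`u₀, v₀` and `u₁, v₁` the solution before and after the step and `w` the inhomogeneity. -/
theorem hamiltonian_step_identity {ι R : Type*} [Fintype ι] [CommRing R] [StarRing R]
    {A B C : Matrix ι ι R} (hB : B.IsHermitian) {u₀ u₁ v₀ v₁ w : ι → R}
    (hu : u₁ - u₀ = A *ᵥ u₁ + B *ᵥ v₀)
    (hv : v₁ - v₀ = C *ᵥ u₁ - Aᴴ *ᵥ v₀ - w) :
    star u₁ ⬝ᵥ v₁ - star u₀ ⬝ᵥ v₀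
      = star u₁ ⬝ᵥ (C *ᵥ u₁) + star v₀ ⬝ᵥ (B *ᵥ v₀) - star u₁ ⬝ᵥ w := by
  have hsplit : star u₁ ⬝ᵥ v₁ - star u₀ ⬝ᵥ v₀
      = star u₁ ⬝ᵥ (v₁ - v₀) + star (u₁ - u₀) ⬝ᵥ v₀ := by
    rw [star_sub, dotProduct_sub, sub_dotProduct]
    ring
  rw [hsplit, hu, hv, star_add, star_mulVec, star_mulVec, hB.eq, add_dotProduct,
    ← dotProduct_mulVec, ← dotProduct_mulVec, dotProduct_sub, dotProduct_sub]
  ring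

/-- if `y = (u; v)` together with `u′` satisfies the
nonhomogeneous system (3.5), with `u(0) = v(0) = 0` and `u(t) = v(t) = 0` for
all sufficiently large `t`, then
`Σ_{t∈ℕ} u*(t+1)W(t)u′(t+1) = Σ_{t∈ℕ} u*(t+1)C(t)u(t+1) + Σ_{t∈ℕ} v*(t)B(t)v(t)`,
all three sums having only finitely many nonzero terms; in particular the
left-hand side is real. -/
theorem compact_support_energy_identity (n : ℕ) (hn : 0 < n)
    (A B C W : ℕ → Matrix (Fin n) (Fin n) ℂ)
    (hA : ∀ t, IsUnit (1 - A t))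
    (hB : ∀ t, (B t).PosSemidef)
    (hC : ∀ t, (C t).IsHermitian)
    (hW : ∀ t, (W t).PosSemidef)
    (u v u' : ℕ → Fin n → ℂ)
    (hu : ∀ t : ℕ, u (t + 1) - u t = A t *ᵥ u (t + 1) + B t *ᵥ v t)
    (hv : ∀ t : ℕ, v (t + 1) - v t
      = C t *ᵥ u (t + 1) - (A t)ᴴ *ᵥ v t - W t *ᵥ u' (t + 1))
    (h0 : u 0 = 0 ∧ v 0 = 0)
    (hfin : ∃ N : ℕ, ∀ t, N ≤ t → u t = 0 ∧ v t = 0) :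
    (Function.support fun t : ℕ =>
      star (u (t + 1)) ⬝ᵥ (W t *ᵥ u' (t + 1))).Finite ∧
    (Function.support fun t : ℕ =>
      star (u (t + 1)) ⬝ᵥ (C t *ᵥ u (t + 1))).Finite ∧
    (Function.support fun t : ℕ =>
      star (v t) ⬝ᵥ (B t *ᵥ v t)).Finite ∧
    (∑' t : ℕ, star (u (t + 1)) ⬝ᵥ (W t *ᵥ u' (t + 1)))
      = (∑' t : ℕ, star (u (t + 1)) ⬝ᵥ (C t *ᵥ u (t + 1)))
        + (∑' t : ℕ, star (v t) ⬝ᵥ (B t *ᵥ v t)) ∧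
    (∑' t : ℕ, star (u (t + 1)) ⬝ᵥ (W t *ᵥ u' (t + 1))).im = 0 := by
  obtain ⟨N, hN⟩ := hfin
  have hu_zero : ∀ t, t ∉ Finset.range N → u (t + 1) = 0 := fun t ht =>
    (hN (t + 1) (by rw [Finset.mem_range] at ht; omega)).1
  have hv_zero : ∀ t, t ∉ Finset.range N → v t = 0 := fun t ht =>
    (hN t (by rw [Finset.mem_range] at ht; omega)).2
  have hW_zero : ∀ t, t ∉ Finset.range N → star (u (t + 1)) ⬝ᵥ (W t *ᵥ u' (t + 1)) = 0 :=
    fun t ht => by simp [hu_zero t ht]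
  have hC_zero : ∀ t, t ∉ Finset.range N → star (u (t + 1)) ⬝ᵥ (C t *ᵥ u (t + 1)) = 0 :=
    fun t ht => by simp [hu_zero t ht]
  have hB_zero : ∀ t, t ∉ Finset.range N → star (v t) ⬝ᵥ (B t *ᵥ v t) = 0 :=
    fun t ht => by simp [hv_zero t ht]
  have finite_support : ∀ f : ℕ → ℂ, (∀ t, t ∉ Finset.range N → f t = 0) →
      (Function.support f).Finite := fun f hf =>
    (Finset.range N).finite_toSet.subset fun t ht => by
      by_contra hmem
      exact ht (hf t hmem)
  have energy : (∑' t : ℕ, star (u (t + 1)) ⬝ᵥ (W t *ᵥ u' (t + 1)))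
      = (∑' t : ℕ, star (u (t + 1)) ⬝ᵥ (C t *ᵥ u (t + 1)))
        + (∑' t : ℕ, star (v t) ⬝ᵥ (B t *ᵥ v t)) := by
    rw [tsum_eq_sum hW_zero, tsum_eq_sum hC_zero, tsum_eq_sum hB_zero]
    have telescope := Finset.sum_range_sub (fun t => star (u t) ⬝ᵥ v t) N
    simp only [hamiltonian_step_identity (hB _).isHermitian (hu _) (hv _), Finset.sum_sub_distrib,
      Finset.sum_add_distrib, h0.2, (hN N le_rfl).2, dotProduct_zero, sub_zero] at telescope
    exact (sub_eq_zero.mp telescope).symm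
  refine ⟨finite_support _ hW_zero, finite_support _ hC_zero, finite_support _ hB_zero,
    energy, ?_⟩
  rw [energy, tsum_eq_sum hC_zero, tsum_eq_sum hB_zero, Complex.add_im, Complex.im_sum,
    Complex.im_sum]
  have hC_im : ∀ t, (star (u (t + 1)) ⬝ᵥ (C t *ᵥ u (t + 1))).im = 0 := fun t =>
    (hC t).im_star_dotProduct_mulVec_self _
  have hB_im : ∀ t, (star (v t) ⬝ᵥ (B t *ᵥ v t)).im = 0 := fun t =>
    (hB t).isHermitian.im_star_dotProduct_mulVec_self _
  simp only [hC_im, hB_im, Finset.sum_const_zero, add_zero]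
end
end

section
/- Let λ₀ ∈ ℝ and assume F_{λ₀} is positive definite on ℕ. Suppose the pair y = (u; v) together with u′ satisfies the nonhomogeneous system (3.5), with u(0) = v(0) = 0 and u(t) = v(t) = 0 for all sufficiently large t. Then Σ_{t∈ℕ} u*(t+1)W(t)u′(t+1) is a real number and satisfies Σ_{t∈ℕ} u*(t+1)W(t)u′(t+1) ≥ λ₀ Σ_{t∈ℕ} u*(t+1)W(t)u(t+1); consequently, for every real λ < λ₀, Σ_{t∈ℕ} u*(t+1)W(t)u′(t+1) − λ Σ_{t∈ℕ} u*(t+1)W(t)u(t+1) ≥ (λ₀ − λ) Σ_{t∈ℕ} u*(t+1)W(t)u(t+1), i.e. the pre-minimal relation minus λ times the identity is bounded from below with a positive lower bound. -/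
open Matrix
open scoped ComplexOrder

noncomputable section

/-- The Lagrange identity: one step of the telescoping sum of `u*(t) v(t)`. -/
theorem star_dotProduct_sub_of_system {n : ℕ} {A B C W : Matrix (Fin n) (Fin n) ℂ}
    (hB : B.IsHermitian) {u₀ u₁ v₀ v₁ w : Fin n → ℂ}
    (hu : u₁ - u₀ = A *ᵥ u₁ + B *ᵥ v₀)
    (hv : v₁ - v₀ = C *ᵥ u₁ - Aᴴ *ᵥ v₀ - W *ᵥ w) :
    star u₁ ⬝ᵥ v₁ - star u₀ ⬝ᵥ v₀
      = star u₁ ⬝ᵥ (C *ᵥ u₁) + star v₀ ⬝ᵥ (B *ᵥ v₀) - star u₁ ⬝ᵥ (W *ᵥ w) := by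
  have hu₀ : u₀ = u₁ - (A *ᵥ u₁ + B *ᵥ v₀) := by rw [← hu]; abel
  have hv₁ : v₁ = v₀ + (C *ᵥ u₁ - Aᴴ *ᵥ v₀ - W *ᵥ w) := by rw [← hv]; abel
  rw [hu₀, hv₁]
  simp only [star_sub, star_add, star_mulVec, hB.eq, sub_dotProduct, add_dotProduct,
    dotProduct_sub, dotProduct_add, dotProduct_mulVec]
  ring

/-- assume the quadratic functional `F_{λ₀}` is positive
definite on `ℕ` (on the space `D₀` of admissible pairs with `u(0) = 0` and `u`
eventually zero, `F_{λ₀}(y) > 0` whenever `u` is not identically zero).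
Suppose `y = (u; v)` together with `u′` satisfies the nonhomogeneous system
(3.5), with `u(0) = v(0) = 0` and `u(t) = v(t) = 0` for all large `t`. Then
`Σ u*(t+1)W(t)u′(t+1)` is real and `≥ λ₀ Σ u*(t+1)W(t)u(t+1)`; consequently
for every real `λ < λ₀`,
`Σ u*(t+1)W(t)u′(t+1) − λ Σ u*(t+1)W(t)u(t+1) ≥ (λ₀ − λ) Σ u*(t+1)W(t)u(t+1)`,
i.e. the pre-minimal relation minus `λ` times the identity is bounded from
below with positive lower bound. -/
theorem preminimal_bounded_below (n : ℕ) (hn : 0 < n)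
    (A B C W : ℕ → Matrix (Fin n) (Fin n) ℂ)
    (hA : ∀ t, IsUnit (1 - A t))
    (hB : ∀ t, (B t).PosSemidef)
    (hC : ∀ t, (C t).IsHermitian)
    (hW : ∀ t, (W t).PosSemidef)
    (lam₀ : ℝ)
    -- `F_{λ₀}` is positive definite on `ℕ`
    (hF : ∀ u v : ℕ → Fin n → ℂ,
      (∀ t : ℕ, u (t + 1) - u t = A t *ᵥ u (t + 1) + B t *ᵥ v t) →
      u 0 = 0 → (∃ N : ℕ, ∀ t, N ≤ t → u t = 0) → u ≠ 0 →
      0 < ((∑' t : ℕ, star (u (t + 1)) ⬝ᵥ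
              ((C t - (lam₀ : ℂ) • W t) *ᵥ u (t + 1)))
            + (∑' t : ℕ, star (v t) ⬝ᵥ (B t *ᵥ v t))).re)
    (u v u' : ℕ → Fin n → ℂ)
    (hu : ∀ t : ℕ, u (t + 1) - u t = A t *ᵥ u (t + 1) + B t *ᵥ v t)
    (hv : ∀ t : ℕ, v (t + 1) - v t
      = C t *ᵥ u (t + 1) - (A t)ᴴ *ᵥ v t - W t *ᵥ u' (t + 1))
    (h0 : u 0 = 0 ∧ v 0 = 0)
    (hfin : ∃ N : ℕ, ∀ t, N ≤ t → u t = 0 ∧ v t = 0) :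
    (∑' t : ℕ, star (u (t + 1)) ⬝ᵥ (W t *ᵥ u' (t + 1))).im = 0 ∧
    lam₀ * (∑' t : ℕ, star (u (t + 1)) ⬝ᵥ (W t *ᵥ u (t + 1))).re
      ≤ (∑' t : ℕ, star (u (t + 1)) ⬝ᵥ (W t *ᵥ u' (t + 1))).re ∧
    ∀ lam : ℝ, lam < lam₀ →
      (lam₀ - lam) * (∑' t : ℕ, star (u (t + 1)) ⬝ᵥ (W t *ᵥ u (t + 1))).re
        ≤ (∑' t : ℕ, star (u (t + 1)) ⬝ᵥ (W t *ᵥ u' (t + 1))).re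
          - lam * (∑' t : ℕ, star (u (t + 1)) ⬝ᵥ (W t *ᵥ u (t + 1))).re := by
  obtain ⟨N, hN⟩ := hfin
  have hu0 : ∀ t, N ≤ t → u (t + 1) = 0 := fun t ht => (hN (t + 1) (by omega)).1
  have finite_sum : ∀ f : ℕ → ℂ, (∀ t, N ≤ t → f t = 0) →
      ∑' t, f t = ∑ t ∈ Finset.range N, f t := fun f hf =>
    tsum_eq_sum fun t ht => hf t (by simpa using ht)
  have hF' := hF u v hu h0.1 ⟨N, fun t ht => (hN t ht).1⟩
  rw [finite_sum _ fun t ht => by simp [hu0 t ht],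
    finite_sum _ fun t ht => by simp [(hN t ht).2]] at hF'
  rw [finite_sum (fun t => star (u (t + 1)) ⬝ᵥ (W t *ᵥ u' (t + 1)))
      fun t ht => by simp [hu0 t ht],
    finite_sum (fun t => star (u (t + 1)) ⬝ᵥ (W t *ᵥ u (t + 1)))
      fun t ht => by simp [hu0 t ht]]
  have key : ∑ t ∈ Finset.range N, star (u (t + 1)) ⬝ᵥ (W t *ᵥ u' (t + 1))
      = ∑ t ∈ Finset.range N, star (u (t + 1)) ⬝ᵥ (C t *ᵥ u (t + 1))
        + ∑ t ∈ Finset.range N, star (v t) ⬝ᵥ (B t *ᵥ v t) := by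
    have h := Finset.sum_range_sub (fun t => star (u t) ⬝ᵥ v t) N
    simp only [h0.1, (hN N le_rfl).1, star_zero, zero_dotProduct, sub_zero,
      fun t => star_dotProduct_sub_of_system (hB t).isHermitian (hu t) (hv t),
      Finset.sum_sub_distrib, Finset.sum_add_distrib] at h
    exact (sub_eq_zero.mp h).symm
  have hle : lam₀ * (∑ t ∈ Finset.range N, star (u (t + 1)) ⬝ᵥ (W t *ᵥ u (t + 1))).re
      ≤ (∑ t ∈ Finset.range N, star (u (t + 1)) ⬝ᵥ (W t *ᵥ u' (t + 1))).re := by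
    by_cases hu_zero : u = 0
    · simp [hu_zero]
    · have h := hF' hu_zero
      simp only [sub_mulVec, smul_mulVec, dotProduct_sub, dotProduct_smul,
        Finset.sum_sub_distrib, ← Finset.mul_sum, smul_eq_mul, Complex.add_re,
        Complex.sub_re, Complex.re_ofReal_mul] at h
      rw [key, Complex.add_re]
      linarith
  refine ⟨?_, hle, fun lam _ => by linarith⟩
  have im_eq_zero {M : Matrix (Fin n) (Fin n) ℂ} (hM : M.IsHermitian) (x : Fin n → ℂ) :
      (star x ⬝ᵥ (M *ᵥ x)).im = 0 := hM.im_star_dotProduct_mulVec_self x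
  simp [key, im_eq_zero (hC _), im_eq_zero (hB _).isHermitian]
end
end

section
/- Suppose for each m ∈ ℕ the pair y_m = (u_m; v_m) together with u′_m satisfies the nonhomogeneous system (3.5) and y_m(0) = 0 (i.e. u_m(0) = v_m(0) = 0), and suppose there is f : ℕ → ℂⁿ such that for each t ∈ ℕ, W(t)u′_m(t+1) → f(t) as m → ∞. Then for each t ∈ ℕ the limit y₀(t) := lim_{m→∞} y_m(t) exists, and y₀ = (u₀; v₀) satisfies u₀(0) = v₀(0) = 0, Δu₀(t) = A(t)u₀(t+1) + B(t)v₀(t), and Δv₀(t) = C(t)u₀(t+1) − A*(t)v₀(t) − f(t) for all t ∈ ℕ. -/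
open Matrix Filter
open scoped ComplexOrder Topology

noncomputable section

theorem tendsto_const_mulVec {ι m n R : Type*} [Fintype n] [NonUnitalNonAssocSemiring R]
    [TopologicalSpace R] [ContinuousAdd R] [ContinuousMul R] {l : Filter ι} {x : ι → n → R}
    {a : n → R} (M : Matrix m n R) (hx : Tendsto x l (𝓝 a)) :
    Tendsto (fun i => M *ᵥ x i) l (𝓝 (M *ᵥ a)) :=
  ((continuous_const.matrix_mulVec continuous_id).tendsto a).comp hx

theorem eq_inv_mulVec_of_sub_eq {n R : Type*} [Fintype n] [DecidableEq n] [CommRing R]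
    {A : Matrix n n R} (hA : IsUnit (1 - A)) {x y b : n → R} (h : x - y = A *ᵥ x + b) :
    x = (1 - A)⁻¹ *ᵥ (y + b) := by
  have hyb : y + b = (1 - A) *ᵥ x := by
    rw [sub_mulVec, one_mulVec, eq_sub_iff_add_eq, add_assoc, add_comm b, ← h, add_sub_cancel]
  rw [hyb, mulVec_mulVec, nonsing_inv_mul _ ((isUnit_iff_isUnit_det _).mp hA), one_mulVec]

/-- suppose for each `m` the pair `y_m = (u_m; v_m)` together
with `u′_m` satisfies the nonhomogeneous system (3.5) with
`u_m(0) = v_m(0) = 0`, and suppose `W(t)u′_m(t+1) → f(t)` as `m → ∞` for each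
`t`. Then for each `t` the limit `y₀(t) = lim_m y_m(t)` exists, and
`y₀ = (u₀; v₀)` satisfies `u₀(0) = v₀(0) = 0`,
`Δu₀(t) = A(t)u₀(t+1) + B(t)v₀(t)` and
`Δv₀(t) = C(t)u₀(t+1) − A*(t)v₀(t) − f(t)` for all `t`. -/
theorem limit_of_solutions (n : ℕ) (hn : 0 < n)
    (A B C W : ℕ → Matrix (Fin n) (Fin n) ℂ)
    (hA : ∀ t, IsUnit (1 - A t))
    (hB : ∀ t, (B t).PosSemidef)
    (hC : ∀ t, (C t).IsHermitian)
    (hW : ∀ t, (W t).PosSemidef)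
    (um vm um' : ℕ → ℕ → Fin n → ℂ)
    (hu : ∀ m t : ℕ,
      um m (t + 1) - um m t = A t *ᵥ um m (t + 1) + B t *ᵥ vm m t)
    (hv : ∀ m t : ℕ,
      vm m (t + 1) - vm m t
        = C t *ᵥ um m (t + 1) - (A t)ᴴ *ᵥ vm m t - W t *ᵥ um' m (t + 1))
    (h0 : ∀ m : ℕ, um m 0 = 0 ∧ vm m 0 = 0)
    (f : ℕ → Fin n → ℂ)
    (hf : ∀ t : ℕ, Tendsto (fun m => W t *ᵥ um' m (t + 1)) atTop (nhds (f t))) :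
    ∃ u₀ v₀ : ℕ → Fin n → ℂ,
      (∀ t : ℕ,
        Tendsto (fun m => um m t) atTop (nhds (u₀ t)) ∧
        Tendsto (fun m => vm m t) atTop (nhds (v₀ t))) ∧
      u₀ 0 = 0 ∧ v₀ 0 = 0 ∧
      (∀ t : ℕ,
        u₀ (t + 1) - u₀ t = A t *ᵥ u₀ (t + 1) + B t *ᵥ v₀ t ∧
        v₀ (t + 1) - v₀ t = C t *ᵥ u₀ (t + 1) - (A t)ᴴ *ᵥ v₀ t - f t) := by
  have exists_lim : ∀ t, ∃ p : (Fin n → ℂ) × (Fin n → ℂ),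
      Tendsto (fun m => um m t) atTop (𝓝 p.1) ∧ Tendsto (fun m => vm m t) atTop (𝓝 p.2) := by
    intro t
    induction t with
    | zero => exact ⟨0, by simp [h0]⟩
    | succ t ih =>
      obtain ⟨p, hp₁, hp₂⟩ := ih
      have hu_lim : Tendsto (fun m => um m (t + 1)) atTop
          (𝓝 ((1 - A t)⁻¹ *ᵥ (p.1 + B t *ᵥ p.2))) := by
        simp only [fun m => eq_inv_mulVec_of_sub_eq (hA t) (hu m t)]
        exact tendsto_const_mulVec _ (hp₁.add (tendsto_const_mulVec _ hp₂))
      have hv_lim := (((tendsto_const_mulVec (C t) hu_lim).sub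
        (tendsto_const_mulVec (A t)ᴴ hp₂)).sub (hf t)).add hp₂
      simp only [← hv, sub_add_cancel] at hv_lim
      exact ⟨(_, _), hu_lim, hv_lim⟩
  choose p hp₁ hp₂ using exists_lim
  refine ⟨fun t => (p t).1, fun t => (p t).2, fun t => ⟨hp₁ t, hp₂ t⟩, ?_, ?_,
    fun t => ⟨?_, ?_⟩⟩
  · exact tendsto_nhds_unique (hp₁ 0) (by simp [h0])
  · exact tendsto_nhds_unique (hp₂ 0) (by simp [h0])
  · refine tendsto_nhds_unique ((hp₁ (t + 1)).sub (hp₁ t)) ?_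
    simp only [hu]
    exact (tendsto_const_mulVec _ (hp₁ (t + 1))).add (tendsto_const_mulVec _ (hp₂ t))
  · refine tendsto_nhds_unique ((hp₂ (t + 1)).sub (hp₂ t)) ?_
    simp only [hv]
    exact ((tendsto_const_mulVec _ (hp₁ (t + 1))).sub (tendsto_const_mulVec _ (hp₂ t))).sub (hf t)
end
end
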